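/- arXiv:2412.04116 — 2 statements merged into one kernel-verified Lean document; each statement's English description precedes it below -/
import Mathlib

section
/- Let G be a connected simple graph on a finite vertex set of cardinality m ≥ 1, and let n be a natural number. Suppose that every vertex of G has degree at most n, and that there exists a vertex w of G with degree strictly less than n. Then there is an enumeration v_1, v_2, …, v_m of the vertices of G such that deg_G(v_1) < n, and for every i with 2 ≤ i ≤ m, the degree of v_i in the subgraph of G induced on the vertex set {v_i, v_{i+1}, …, v_m} (i.e., G with v_1, …, v_{i-1} deleted) is strictly less than n. -/
/-- In a connected graph, every vertex other than `w` has a neighbour strictly closer to `w`. -/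
theorem SimpleGraph.Connected.exists_adj_dist_lt {V : Type*} {G : SimpleGraph V}
    (hG : G.Connected) {v w : V} (hvw : v ≠ w) : ∃ u, G.Adj v u ∧ G.dist u w < G.dist v w := by
  obtain ⟨p, hp⟩ := hG.exists_walk_length_eq_dist v w
  cases p with
  | nil => exact absurd rfl hvw
  | cons h q =>
    refine ⟨_, h, ?_⟩
    have hq := SimpleGraph.dist_le q
    rw [SimpleGraph.Walk.length_cons] at hp
    omega

/-- A finite type can be enumerated so that a given linearly ordered weight is monotone. -/
theorem Fintype.exists_equiv_fin_monotone {α β : Type*} [Fintype α] [LinearOrder β] {m : ℕ}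
    (hcard : Fintype.card α = m) (f : α → β) : ∃ e : Fin m ≃ α, Monotone (f ∘ e) := by
  let e := (Fintype.equivFinOfCardEq hcard).symm
  exact ⟨(Tuple.sort (f ∘ e)).trans e, Tuple.monotone_sort (f ∘ e)⟩


/-- A connected simple graph on `m ≥ 1` vertices in which every vertex
has degree at most `n` and some vertex has degree strictly less than `n` admits an
ordering `v_1, …, v_m` of its vertices such that `deg_G(v_1) < n` and, for `2 ≤ i ≤ m`,
the degree of `v_i` in the subgraph induced on `{v_i, …, v_m}` is strictly less than `n`. -/
theorem stmt0 {V : Type*} [Fintype V] [DecidableEq V]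
    (G : SimpleGraph V) [DecidableRel G.Adj]
    (m n : ℕ) (hm : 1 ≤ m) (hcard : Fintype.card V = m)
    (hconn : G.Connected)
    (hdeg : ∀ v : V, G.degree v ≤ n)
    (hw : ∃ w : V, G.degree w < n) :
    ∃ e : Fin m ≃ V,
      G.degree (e ⟨0, hm⟩) < n ∧
      ∀ i : Fin m, 1 ≤ (i : ℕ) →
        (Finset.univ.filter fun u : V => G.Adj (e i) u ∧ i ≤ e.symm u).card < n := by
  obtain ⟨w, hw⟩ := hw
  obtain ⟨e, he⟩ := Fintype.exists_equiv_fin_monotone hcard fun v => G.dist v w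
  have he0 : e ⟨0, hm⟩ = w := by
    have h : G.dist (e ⟨0, hm⟩) w ≤ G.dist (e (e.symm w)) w := he (Nat.zero_le _)
    rw [e.apply_symm_apply, SimpleGraph.dist_self, Nat.le_zero] at h
    exact hconn.dist_eq_zero_iff.mp h
  refine ⟨e, he0 ▸ hw, fun i hi => ?_⟩
  have hiw : e i ≠ w := by
    rw [← he0]
    intro h
    have := congrArg Fin.val (e.injective h)
    simp only at this
    omega
  obtain ⟨u, hu, hlt⟩ := hconn.exists_adj_dist_lt hiw
  refine lt_of_lt_of_le (Finset.card_lt_card ?_) (hdeg (e i))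
  refine Finset.ssubset_iff_of_subset (fun x hx => ?_) |>.mpr ⟨u, ?_, fun hmem => ?_⟩
  · exact (G.mem_neighborFinset _ _).mpr (Finset.mem_filter.mp hx).2.1
  · exact (G.mem_neighborFinset _ _).mpr hu
  · have h : G.dist (e i) w ≤ G.dist (e (e.symm u)) w := he (Finset.mem_filter.mp hmem).2.2
    rw [e.apply_symm_apply] at h
    omega
end

section
/- Let K be a simplicial complex and let σ be a maximal face of K. Suppose there exists a subcomplex L of K∖σ (a subset of K∖σ that is itself a simplicial complex) such that L ∪ ∂σ = K∖σ and ∂σ ∩ L ≠ ∂σ. Then there exists a face τ of ∂σ with |τ| = |σ| − 1 such that τ is a maximal face of K∖σ. -/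
/-- A simplicial complex: a set of nonempty finite subsets (faces) closed under
passing to nonempty subsets. -/
def IsSimplicialComplex {V : Type*} (K : Set (Finset V)) : Prop :=
  (∀ s ∈ K, s.Nonempty) ∧ ∀ s ∈ K, ∀ t : Finset V, t ⊆ s → t.Nonempty → t ∈ K

/-- `σ` is a maximal face of `K`. -/
def IsMaximalFace {V : Type*} (K : Set (Finset V)) (σ : Finset V) : Prop :=
  σ ∈ K ∧ ∀ γ ∈ K, σ ⊆ γ → γ = σ

/-- The boundary `∂σ` of a simplex `σ`: the nonempty proper subsets of `σ`. -/
def simplexBoundary {V : Type*} (σ : Finset V) : Set (Finset V) :=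
  {τ | τ.Nonempty ∧ τ ⊂ σ}

/-- if `K∖σ` decomposes as `L ∪ ∂σ` with `L` a subcomplex of `K∖σ`
and `∂σ ∩ L ≠ ∂σ`, then some face `τ` of `∂σ` with `|τ| = |σ| - 1` is maximal in `K∖σ`. -/
theorem stmt1 {V : Type*} (K : Set (Finset V)) (hK : IsSimplicialComplex K)
    (σ : Finset V) (hσ : IsMaximalFace K σ)
    (L : Set (Finset V)) (hLsub : L ⊆ K \ {σ}) (hL : IsSimplicialComplex L)
    (hunion : L ∪ simplexBoundary σ = K \ {σ})
    (hne : simplexBoundary σ ∩ L ≠ simplexBoundary σ) :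
    ∃ τ ∈ simplexBoundary σ, τ.card = σ.card - 1 ∧ IsMaximalFace (K \ {σ}) τ := by
  classical
  obtain ⟨ρ, hρ, hρL⟩ : ∃ ρ ∈ simplexBoundary σ, ρ ∉ L := by
    by_contra! h
    exact hne (Set.inter_eq_left.mpr h)
  obtain ⟨a, haσ, haρ⟩ := Finset.exists_of_ssubset hρ.2
  have hρτ : ρ ⊆ σ.erase a := Finset.subset_erase.mpr ⟨hρ.2.subset, haρ⟩
  have hτ : σ.erase a ∈ simplexBoundary σ := ⟨hρ.1.mono hρτ, Finset.erase_ssubset haσ⟩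
  refine ⟨σ.erase a, hτ, Finset.card_erase_of_mem haσ, hunion ▸ Or.inr hτ, fun γ hγ hτγ => ?_⟩
  rw [← hunion] at hγ
  rcases hγ with hγL | hγσ
  · exact absurd (hL.2 γ hγL ρ (hρτ.trans hτγ) hρ.1) hρL
  · refine (Finset.eq_of_subset_of_card_le hτγ ?_).symm
    rw [Finset.card_erase_of_mem haσ]
    exact Nat.le_sub_one_of_lt (Finset.card_lt_card hγσ.2)
end
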